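/- Let Y denote Young's lattice, the poset of all integer partitions (equivalently, Young diagrams) ordered by containment, which is a 1-differential poset. For every r ≥ 1, the r-fold Cartesian product Y^r (with componentwise order) is an r-differential poset, and for every n ≥ 0 the matrix [DU_n] + x·I_{p_n} of Y^r has Smith normal form over ℤ[x]. -/

import Mathlib

open Polynomial

/-- A rectangular matrix over a commutative ring has Smith normal form: there are
invertible matrices `P`, `Q` such that `P * A * Q` is diagonal with diagonal entries
forming a divisibility chain. -/
def Matrix.HasSNF {R : Type*} [CommRing R] {m n : ℕ} (A : Matrix (Fin m) (Fin n) R) : Prop :=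
  ∃ (P : Matrix (Fin m) (Fin m) R) (Q : Matrix (Fin n) (Fin n) R),
    IsUnit P ∧ IsUnit Q ∧
    (∀ (i : Fin m) (j : Fin n), (i : ℕ) ≠ (j : ℕ) → (P * A * Q) i j = 0) ∧
    (∀ (i : ℕ) (h₁ : i + 1 < m) (h₂ : i + 1 < n),
      (P * A * Q) ⟨i, Nat.lt_of_succ_lt h₁⟩ ⟨i, Nat.lt_of_succ_lt h₂⟩ ∣
        (P * A * Q) ⟨i + 1, h₁⟩ ⟨i + 1, h₂⟩)

/-- SNF for matrices with arbitrary finite index types. -/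
def Matrix.HasSNF' {ι κ R : Type*} [Fintype ι] [Fintype κ] [CommRing R]
    (A : Matrix ι κ R) : Prop :=
  ∃ (eι : ι ≃ Fin (Fintype.card ι)) (eκ : κ ≃ Fin (Fintype.card κ)),
    Matrix.HasSNF (Matrix.reindex eι eκ A)


lemma YoungDiagram.cell_lt_card (μ : YoungDiagram) {i j : ℕ} (h : (i, j) ∈ μ) :
    i < μ.card ∧ j < μ.card := by
  constructor
  · have hsub : (Finset.range (i + 1)).image (fun k => (k, j)) ⊆ μ.cells := by
      intro c hc
      simp only [Finset.mem_image, Finset.mem_range, Nat.lt_succ_iff] at hc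
      obtain ⟨k, hk, rfl⟩ := hc
      exact μ.up_left_mem hk le_rfl h
    have : i + 1 ≤ μ.card := by
      calc i + 1 = ((Finset.range (i + 1)).image (fun k => (k, j))).card := by
            rw [Finset.card_image_of_injective _ (fun a b hab => by simpa using hab)]
            simp
        _ ≤ μ.card := Finset.card_le_card hsub
    omega
  · have hsub : (Finset.range (j + 1)).image (fun k => (i, k)) ⊆ μ.cells := by
      intro c hc
      simp only [Finset.mem_image, Finset.mem_range, Nat.lt_succ_iff] at hc
      obtain ⟨k, hk, rfl⟩ := hc
      exact μ.up_left_mem le_rfl hk h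
    have : j + 1 ≤ μ.card := by
      calc j + 1 = ((Finset.range (j + 1)).image (fun k => (i, k))).card := by
            rw [Finset.card_image_of_injective _ (fun a b hab => by simpa using hab)]
            simp
        _ ≤ μ.card := Finset.card_le_card hsub
    omega

lemma youngFiber_finite (n : ℕ) : {μ : YoungDiagram | μ.card ≤ n}.Finite := by
  apply Set.Finite.of_finite_image (f := YoungDiagram.cells)
  · apply Set.Finite.subset ((Finset.range n ×ˢ Finset.range n).powerset : Finset _).finite_toSet
    rintro s ⟨μ, hμ, rfl⟩
    simp only [Finset.coe_powerset, Set.mem_preimage, Set.mem_powerset_iff,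
      Finset.coe_subset]
    intro c hc
    have h1 := μ.cell_lt_card (i := c.1) (j := c.2) (by simpa using hc)
    simp only [Finset.mem_product, Finset.mem_range]
    exact ⟨lt_of_lt_of_le h1.1 hμ, lt_of_lt_of_le h1.2 hμ⟩
  · exact fun μ _ ν _ h => YoungDiagram.ext h

lemma yrLevel_finite (r n : ℕ) :
    {x : Fin r → YoungDiagram | ∑ i, (x i).card = n}.Finite := by
  apply Set.Finite.subset (Set.Finite.pi (fun _ : Fin r => youngFiber_finite n))
  intro x hx
  simp only [Set.mem_pi, Set.mem_univ, forall_true_left]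
  intro i
  simp only [Set.mem_setOf_eq] at hx ⊢
  calc (x i).card ≤ ∑ j, (x j).card := Finset.single_le_sum (f := fun j => (x j).card) (fun _ _ => Nat.zero_le _) (Finset.mem_univ i)
    _ = n := hx

/-- The `n`-th rank of the `r`-fold Cartesian product `Y^r` of Young's lattice. -/
abbrev YLevel (r n : ℕ) : Type := {x : Fin r → YoungDiagram // ∑ i, (x i).card = n}

noncomputable instance (r n : ℕ) : Fintype (YLevel r n) := (yrLevel_finite r n).fintype

noncomputable instance (r n : ℕ) : DecidableEq (YLevel r n) := Classical.decEq _

noncomputable instance (x y : Fin r → YoungDiagram) : Decidable (x ⋖ y) := Classical.dec _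

/-- The matrix of the up map `U_n` of `Y^r` in the standard basis. -/
noncomputable def yUpMatrix (R : Type*) [CommRing R] (r n : ℕ) :
    Matrix (YLevel r (n + 1)) (YLevel r n) R :=
  fun y x => if x.1 ⋖ y.1 then 1 else 0

/-- The matrix of the down map `D_{n+1}` of `Y^r` in the standard basis. -/
noncomputable def yDownMatrix (R : Type*) [CommRing R] (r n : ℕ) :
    Matrix (YLevel r n) (YLevel r (n + 1)) R :=
  fun y x => if y.1 ⋖ x.1 then 1 else 0

/-- The matrix `[DU_n]` of `Y^r` in the standard basis. -/
noncomputable def yDuMatrix (R : Type*) [CommRing R] (r n : ℕ) :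
    Matrix (YLevel r n) (YLevel r n) R :=
  yDownMatrix R r n * yUpMatrix R r n

namespace YoungDiagram

/-- A cell may be added at the end of row `i`. -/
def Addable (μ : YoungDiagram) (i : ℕ) : Prop := ∀ k < i, μ.rowLen i < μ.rowLen k

/-- The diagram obtained by adding a cell at the end of row `i`. -/
def addCell (μ : YoungDiagram) (i : ℕ) (h : μ.Addable i) : YoungDiagram where
  cells := insert (i, μ.rowLen i) μ.cells
  isLowerSet := by
    rintro ⟨a, b⟩ ⟨c, d⟩ ⟨hca, hdb⟩ hab
    simp only [Finset.coe_insert, Set.mem_insert_iff, Finset.mem_coe, mem_cells,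
      Prod.mk.injEq, mem_iff_lt_rowLen] at hab ⊢
    dsimp only at hca hdb
    rcases hab with ⟨rfl, rfl⟩ | hab
    · rcases hca.lt_or_eq with hlt | rfl
      · exact Or.inr (hdb.trans_lt (h c hlt))
      · rcases hdb.lt_or_eq with hlt | rfl
        · exact Or.inr hlt
        · exact Or.inl ⟨rfl, rfl⟩
    · exact Or.inr (hdb.trans_lt (hab.trans_le (μ.rowLen_anti _ _ hca)))

lemma le_iff_rowLen_le {μ ν : YoungDiagram} : μ ≤ ν ↔ ∀ i, μ.rowLen i ≤ ν.rowLen i := by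
  refine ⟨fun h i => ?_, fun h => ?_⟩
  · by_contra! hlt
    exact lt_irrefl _ (mem_iff_lt_rowLen.1 (h (mem_iff_lt_rowLen.2 hlt)))
  · rintro ⟨i, j⟩ hij
    exact mem_iff_lt_rowLen.2 ((mem_iff_lt_rowLen.1 hij).trans_le (h i))

lemma eq_of_rowLen_eq {μ ν : YoungDiagram} (h : ∀ i, μ.rowLen i = ν.rowLen i) : μ = ν :=
  le_antisymm (le_iff_rowLen_le.2 fun i => (h i).le) (le_iff_rowLen_le.2 fun i => (h i).ge)

lemma mem_addCell {μ : YoungDiagram} {i : ℕ} {h : μ.Addable i} {c : ℕ × ℕ} :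
    c ∈ μ.addCell i h ↔ c = (i, μ.rowLen i) ∨ c ∈ μ := by
  rw [← mem_cells]
  simp [addCell]

lemma rowLen_addCell (μ : YoungDiagram) (i : ℕ) (h : μ.Addable i) (k : ℕ) :
    (μ.addCell i h).rowLen k = μ.rowLen k + if k = i then 1 else 0 := by
  refine eq_of_forall_lt_iff fun j => ?_
  rw [← mem_iff_lt_rowLen, mem_addCell, mem_iff_lt_rowLen, Prod.mk.injEq]
  split_ifs with hk
  · subst hk; omega
  · omega

lemma colLen_zero_addCell (μ : YoungDiagram) (i : ℕ) (h : μ.Addable i) :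
    (μ.addCell i h).colLen 0 = μ.colLen 0 + if i = μ.colLen 0 then 1 else 0 := by
  refine eq_of_forall_lt_iff fun j => ?_
  rw [← mem_iff_lt_colLen, mem_addCell, Prod.mk.injEq, mem_iff_lt_colLen]
  have h0 : 0 = μ.rowLen i ↔ μ.colLen 0 ≤ i := by
    rw [← not_lt, ← mem_iff_lt_colLen, mem_iff_lt_rowLen]; omega
  have h1 : μ.colLen 0 ≤ i → i = μ.colLen 0 := fun hi => by
    refine le_antisymm (not_lt.1 fun hlt => ?_) hi
    have h2 := h _ hlt
    have h3 : ¬ (μ.colLen 0, 0) ∈ μ := by rw [mem_iff_lt_colLen]; omega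
    rw [mem_iff_lt_rowLen] at h3
    omega
  rw [h0]
  split_ifs with hk
  · omega
  · have := mt h1 hk; omega

lemma card_addCell (μ : YoungDiagram) (i : ℕ) (h : μ.Addable i) :
    (μ.addCell i h).card = μ.card + 1 := by
  refine Finset.card_insert_of_notMem ?_
  rw [mem_cells, mem_iff_lt_rowLen]
  exact lt_irrefl _

lemma lt_addCell (μ : YoungDiagram) (i : ℕ) (h : μ.Addable i) : μ < μ.addCell i h := by
  rw [← cells_ssubset_iff]
  refine Finset.ssubset_insert ?_
  rw [mem_cells, mem_iff_lt_rowLen]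
  exact lt_irrefl _

lemma covBy_addCell (μ : YoungDiagram) (i : ℕ) (h : μ.Addable i) : μ ⋖ μ.addCell i h := by
  refine ⟨μ.lt_addCell i h, fun ν h1 h2 => ?_⟩
  have h1 : μ.card < ν.card := Finset.card_lt_card (cells_ssubset_iff.2 h1)
  have h2 : ν.card < (μ.addCell i h).card := Finset.card_lt_card (cells_ssubset_iff.2 h2)
  rw [card_addCell] at h2
  omega

lemma covBy_iff {μ ν : YoungDiagram} : μ ⋖ ν ↔ ∃ i, ∃ h : μ.Addable i, ν = μ.addCell i h := by
  refine ⟨fun h => ?_, ?_⟩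
  · have hex : ∃ i, μ.rowLen i < ν.rowLen i := by
      by_contra! hle
      exact h.lt.not_ge (le_iff_rowLen_le.2 hle)
    classical
    have hspec := Nat.find_spec hex
    have hmin := fun k (hk : k < Nat.find hex) => not_lt.1 (Nat.find_min hex hk)
    set i := Nat.find hex
    have hadd : μ.Addable i := fun k hk =>
      (hspec.trans_le (ν.rowLen_anti _ _ hk.le)).trans_le (hmin k hk)
    have hle : μ.addCell i hadd ≤ ν := le_iff_rowLen_le.2 fun k => by
      have := le_iff_rowLen_le.1 h.le k
      rw [rowLen_addCell]
      split_ifs with hk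
      · subst hk; exact hspec
      · exact this
    refine ⟨i, hadd, ?_⟩
    by_contra hne
    exact h.2 (μ.lt_addCell i hadd) (lt_of_le_of_ne hle (Ne.symm hne))
  · rintro ⟨i, h, rfl⟩
    exact μ.covBy_addCell i h

lemma card_eq_of_covBy {μ ν : YoungDiagram} (h : μ ⋖ ν) : ν.card = μ.card + 1 := by
  obtain ⟨i, hi, rfl⟩ := covBy_iff.1 h
  exact μ.card_addCell i hi

/-- If row `i` is longer than row `i + 1`, its last cell can be removed. -/
lemma exists_addCell_eq (ν : YoungDiagram) (i : ℕ) (h : ν.rowLen (i + 1) < ν.rowLen i) :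
    ∃ μ : YoungDiagram, ∃ hi : μ.Addable i, μ.addCell i hi = ν := by
  let μ : YoungDiagram :=
    { cells := ν.cells.erase (i, ν.rowLen i - 1)
      isLowerSet := by
        rintro ⟨a, b⟩ ⟨c, d⟩ ⟨hca, hdb⟩ hab
        simp only [Finset.coe_erase, Set.mem_sdiff, Finset.mem_coe, mem_cells,
          Set.mem_singleton_iff, Prod.mk.injEq] at hab ⊢
        dsimp only at hca hdb
        refine ⟨ν.up_left_mem hca hdb hab.1, ?_⟩
        rintro ⟨rfl, rfl⟩
        have h1 := mem_iff_lt_rowLen.1 hab.1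
        rcases hca.lt_or_eq with hlt | rfl
        · have := ν.rowLen_anti (c + 1) a hlt
          omega
        · exact hab.2 ⟨rfl, by omega⟩ }
  have hμ : ∀ k, ν.rowLen k = μ.rowLen k + if k = i then 1 else 0 := fun k => by
    refine eq_of_forall_lt_iff fun j => ?_
    have : ∀ j, j < μ.rowLen k ↔ ¬ (k = i ∧ j = ν.rowLen i - 1) ∧ j < ν.rowLen k := fun j => by
      rw [← mem_iff_lt_rowLen, ← mem_iff_lt_rowLen, ← mem_cells]
      simp [μ]
    have hj := this j
    split_ifs with hk
    · subst hk
      have h1 := this (μ.rowLen k)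
      have h2 := this (ν.rowLen k - 2)
      have h3 := this (ν.rowLen k - 1)
      omega
    · simp only [hk, false_and, not_false_eq_true, true_and] at hj
      omega
  have hadd : μ.Addable i := fun k hk => by
    have h1 := hμ k
    have h2 := hμ i
    have h3 := ν.rowLen_anti k i hk.le
    rw [if_neg hk.ne] at h1
    rw [if_pos rfl] at h2
    omega
  exact ⟨μ, hadd, eq_of_rowLen_eq fun k => by rw [rowLen_addCell, hμ]⟩

/-- Young's lattice is 1-differential: a diagram is covered by one element more than it covers. -/
lemma ncard_covers (μ : YoungDiagram) :
    {ν | μ ⋖ ν}.ncard = {ν | ν ⋖ μ}.ncard + 1 := by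
  have h1 : {i | μ.Addable i}.ncard = {ν | μ ⋖ ν}.ncard := by
    refine Set.ncard_congr (fun i hi => μ.addCell i hi) (fun i hi => μ.covBy_addCell i hi) ?_ ?_
    · intro i j hi hj hij
      have := congrArg (fun ν => ν.rowLen i) hij
      simp only [rowLen_addCell] at this
      by_contra hne
      simp [hne] at this
    · intro ν hν
      obtain ⟨i, hi, rfl⟩ := covBy_iff.1 hν
      exact ⟨i, hi, rfl⟩
  have h2 : {i | μ.rowLen (i + 1) < μ.rowLen i}.ncard = {ν | ν ⋖ μ}.ncard := by
    refine Set.ncard_congr (fun i hi => (μ.exists_addCell_eq i hi).choose) ?_ ?_ ?_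
    · intro i hi
      obtain ⟨h, he⟩ := (μ.exists_addCell_eq i hi).choose_spec
      exact covBy_iff.2 ⟨i, h, he.symm⟩
    · intro i j hi hj hij
      obtain ⟨h, he⟩ := (μ.exists_addCell_eq i hi).choose_spec
      obtain ⟨h', he'⟩ := (μ.exists_addCell_eq j hj).choose_spec
      have e1 := congrArg (fun ν => ν.rowLen i) he
      have e2 := congrArg (fun ν => ν.rowLen i) he'
      simp only [rowLen_addCell] at e1 e2
      rw [← hij, ← e1] at e2
      by_contra hne
      simp [hne] at e2
    · intro ν hν
      obtain ⟨i, h, rfl⟩ := covBy_iff.1 hν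
      have hi : (ν.addCell i h).rowLen (i + 1) < (ν.addCell i h).rowLen i := by
        have := ν.rowLen_anti i (i + 1) (Nat.le_succ i)
        simp only [rowLen_addCell]
        simp; omega
      refine ⟨i, hi, ?_⟩
      obtain ⟨h', he⟩ := ((ν.addCell i h).exists_addCell_eq i hi).choose_spec
      refine eq_of_rowLen_eq fun k => ?_
      have := congrArg (fun ν => ν.rowLen k) he
      simpa only [rowLen_addCell, add_left_inj] using this
  have h3 : {i | μ.Addable i} = insert 0 (Nat.succ '' {i | μ.rowLen (i + 1) < μ.rowLen i}) := by
    ext i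
    cases i with
    | zero => simp [Addable]
    | succ i =>
      have : μ.Addable (i + 1) ↔ μ.rowLen (i + 1) < μ.rowLen i :=
        ⟨fun h => h i (Nat.lt_succ_self i), fun h k hk =>
          h.trans_le (μ.rowLen_anti _ _ (Nat.lt_succ_iff.1 hk))⟩
      simp [this]
  have hfin : {i | μ.rowLen (i + 1) < μ.rowLen i}.Finite := by
    refine (Set.finite_lt_nat (μ.colLen 0)).subset fun i hi => ?_
    rw [Set.mem_ofPred_eq, ← mem_iff_lt_colLen, mem_iff_lt_rowLen]
    exact (Nat.zero_le _).trans_lt hi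
  rw [← h1, ← h2, h3, Set.ncard_insert_of_notMem (by simp) (hfin.image _), Set.ncard_image_of_injective _
    Nat.succ_injective]

end YoungDiagram

namespace YoungTuple

open YoungDiagram

variable {r : ℕ}

/-- The rank of an `r`-tuple of Young diagrams. -/
def size (x : Fin r → YoungDiagram) : ℕ := ∑ i, (x i).card

lemma covBy_iff {x y : Fin r → YoungDiagram} : x ⋖ y ↔ ∃ i k, ∃ h : (x i).Addable k,
    y = Function.update x i ((x i).addCell k h) := by
  rw [Pi.covBy_iff]
  constructor
  · rintro ⟨i, hi, hj⟩
    obtain ⟨k, h, he⟩ := YoungDiagram.covBy_iff.1 hi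
    refine ⟨i, k, h, funext fun j => ?_⟩
    by_cases hji : j = i
    · subst hji; simpa using he
    · simp [hji, hj j hji]
  · rintro ⟨i, k, h, rfl⟩
    exact ⟨i, by simpa using covBy_addCell _ _ _, fun j hj => by simp [hj]⟩

lemma size_eq_of_covBy {x y : Fin r → YoungDiagram} (h : x ⋖ y) : size y = size x + 1 := by
  obtain ⟨i, hi, hj⟩ := Pi.covBy_iff.1 h
  unfold size
  rw [← Finset.add_sum_erase _ _ (Finset.mem_univ i),
    ← Finset.add_sum_erase _ (fun j => (x j).card) (Finset.mem_univ i), card_eq_of_covBy hi,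
    Finset.sum_congr rfl fun j hj' => by rw [← hj j (Finset.ne_of_mem_erase hj')]]
  ring

lemma finite_size_eq (n : ℕ) : {x : Fin r → YoungDiagram | size x = n}.Finite :=
  yrLevel_finite r n

lemma size_mono {x y : Fin r → YoungDiagram} (h : x ≤ y) : size x ≤ size y :=
  Finset.sum_le_sum fun i _ => Finset.card_le_card (cells_subset_iff.2 (h i))

lemma size_strictMono : StrictMono (size : (Fin r → YoungDiagram) → ℕ) := fun x y h => by
  obtain ⟨hle, i, hi⟩ := Pi.lt_def.1 h
  exact Finset.sum_lt_sum (fun j _ => Finset.card_le_card (cells_subset_iff.2 (hle j)))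
    ⟨i, Finset.mem_univ i, Finset.card_lt_card (cells_ssubset_iff.2 hi)⟩

lemma eq_bot_of_size_eq_zero {x : Fin r → YoungDiagram} (h : size x = 0) : x = ⊥ := by
  funext i
  refine YoungDiagram.ext (Finset.card_eq_zero.1 ?_)
  exact Finset.sum_eq_zero_iff.1 h i (Finset.mem_univ i)

lemma finite_Iic (y : Fin r → YoungDiagram) : (Set.Iic y).Finite := by
  refine ((Set.finite_le_nat (size y)).biUnion fun n _ => finite_size_eq n).subset fun x hx => ?_
  exact Set.mem_biUnion (size_mono hx : size x ∈ {n | n ≤ size y}) rfl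

lemma finite_upperCovers (x : Fin r → YoungDiagram) : {y | x ⋖ y}.Finite :=
  (finite_size_eq (size x + 1)).subset fun _ h => size_eq_of_covBy h

lemma finite_lowerCovers (x : Fin r → YoungDiagram) : {y | y ⋖ x}.Finite :=
  (finite_Iic x).subset fun _ h => h.le

lemma size_bot : size (⊥ : Fin r → YoungDiagram) = 0 := by
  simp [size, YoungDiagram.card]

/-- The tuples differing from `x` in exactly one place, where they lie in `S i`. -/
lemma ncard_update_mem (x : Fin r → YoungDiagram) (S : Fin r → Set YoungDiagram)
    (hS : ∀ i, x i ∉ S i)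
    (hfin : {y : Fin r → YoungDiagram | ∃ i, y i ∈ S i ∧ ∀ j, j ≠ i → y j = x j}.Finite) :
    {y : Fin r → YoungDiagram | ∃ i, y i ∈ S i ∧ ∀ j, j ≠ i → y j = x j}.ncard =
      ∑ i, (S i).ncard := by
  have hmem : ∀ i, ∀ ν ∈ S i, Function.update x i ν ∈
      {y : Fin r → YoungDiagram | ∃ i, y i ∈ S i ∧ ∀ j, j ≠ i → y j = x j} :=
    fun i ν hν => ⟨i, by simpa using hν, fun j hj => by simp [hj]⟩
  have hSfin : ∀ i, Finite (S i) := fun i =>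
    Set.Finite.of_injOn (f := Function.update x i) (hmem i)
      (Function.update_injective x i).injOn hfin
  simp_rw [← Nat.card_coe_set_eq]
  rw [← Nat.card_sigma]
  refine (Nat.card_congr (Equiv.ofBijective (fun p : Σ i, S i =>
    ⟨Function.update x p.1 p.2.1, hmem p.1 p.2.1 p.2.2⟩) ⟨?_, ?_⟩)).symm
  · rintro ⟨i, ν, hν⟩ ⟨j, κ, hκ⟩ h
    have h := Subtype.ext_iff.1 h
    dsimp only at h
    have hij : i = j := by
      by_contra hne
      have := congrFun h i
      rw [Function.update_self, Function.update_of_ne hne] at this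
      exact hS i (this ▸ hν)
    subst hij
    obtain rfl := Function.update_injective x i h
    rfl
  · rintro ⟨y, i, hi, hj⟩
    refine ⟨⟨i, y i, hi⟩, Subtype.ext (funext fun j => ?_)⟩
    by_cases hji : j = i
    · subst hji; simp
    · simp [hji, hj j hji]

lemma ncard_upperCovers (x : Fin r → YoungDiagram) :
    {y | x ⋖ y}.ncard = {y | y ⋖ x}.ncard + r := by
  have hup : {y | x ⋖ y} = {y | ∃ i, y i ∈ {ν | x i ⋖ ν} ∧ ∀ j, j ≠ i → y j = x j} := by
    ext y
    simp only [Set.mem_ofPred_eq, Pi.covBy_iff, eq_comm]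
  have hdown : {y | y ⋖ x} = {y | ∃ i, y i ∈ {ν | ν ⋖ x i} ∧ ∀ j, j ≠ i → y j = x j} := by
    ext y
    simp only [Set.mem_ofPred_eq, Pi.covBy_iff]
  have h1 := finite_upperCovers x
  have h2 := finite_lowerCovers x
  rw [hup] at h1 ⊢
  rw [hdown] at h2 ⊢
  rw [ncard_update_mem x _ (fun i (h : x i ⋖ x i) => h.lt.false) h1,
    ncard_update_mem x _ (fun i (h : x i ⋖ x i) => h.lt.false) h2]
  simp [YoungDiagram.ncard_covers, Finset.sum_add_distrib]

/-- In a lattice, an element covered by two distinct elements is their meet. -/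
lemma inf_eq_of_covBy {α : Type*} [Lattice α] {x u v : α} (hu : x ⋖ u) (hv : x ⋖ v)
    (h : u ≠ v) : u ⊓ v = x := by
  rcases hu.eq_or_eq (le_inf hu.le hv.le) inf_le_left with he | he
  · exact he
  · rcases hv.eq_or_eq hu.le (inf_eq_left.1 he) with h' | h'
    · exact absurd h' hu.lt.ne'
    · exact absurd h' h

/-- In a lattice, a common cover of two distinct elements is their join. -/
lemma sup_eq_of_covBy {α : Type*} [Lattice α] {x u v : α} (hu : u ⋖ x) (hv : v ⋖ x)
    (h : u ≠ v) : u ⊔ v = x :=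
  inf_eq_of_covBy (α := αᵒᵈ) hu.toDual hv.toDual h

lemma covBy_sup_of_covBy {α : Type*} [Lattice α] [IsModularLattice α] {x u v : α}
    (hu : x ⋖ u) (hv : x ⋖ v) (h : u ≠ v) : u ⋖ u ⊔ v ∧ v ⋖ u ⊔ v := by
  have he := inf_eq_of_covBy hu hv h
  exact ⟨covBy_sup_of_inf_covBy_right (he.symm ▸ hv), covBy_sup_of_inf_covBy_left (he.symm ▸ hu)⟩

lemma inf_covBy_of_covBy {α : Type*} [Lattice α] [IsModularLattice α] {x u v : α}
    (hu : u ⋖ x) (hv : v ⋖ x) (h : u ≠ v) : u ⊓ v ⋖ u ∧ u ⊓ v ⋖ v := by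
  have he := sup_eq_of_covBy hu hv h
  exact ⟨inf_covBy_of_covBy_sup_right (he.symm ▸ hv), inf_covBy_of_covBy_sup_left (he.symm ▸ hu)⟩

/-- Two distinct elements of a modular lattice cover a common element exactly when they have a
common cover, and both are unique. -/
lemma ncard_common_covers {α : Type*} [Lattice α] [IsModularLattice α] {x y : α} (hxy : x ≠ y) :
    {z | z ⋖ x ∧ z ⋖ y}.ncard = {z | x ⋖ z ∧ y ⋖ z}.ncard := by
  refine Set.ncard_congr (fun _ _ => x ⊔ y) (fun z hz => covBy_sup_of_covBy hz.1 hz.2 hxy) ?_ ?_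
  · intro z w hz hw _
    rw [← inf_eq_of_covBy hz.1 hz.2 hxy, ← inf_eq_of_covBy hw.1 hw.2 hxy]
  · intro z hz
    exact ⟨x ⊓ y, inf_covBy_of_covBy hz.1 hz.2 hxy, sup_eq_of_covBy hz.1 hz.2 hxy⟩

section Statistic

variable {a b : Fin r}

/-- The length of the first row of the `a`-th diagram minus that of the first column of the
`b`-th diagram. -/
def stat (a b : Fin r) (x : Fin r → YoungDiagram) : ℤ := (x a).rowLen 0 - (x b).colLen 0

lemma addable_zero (μ : YoungDiagram) : μ.Addable 0 := fun _ h => absurd h (Nat.not_lt_zero _)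

/-- Add a cell to the first row of the `a`-th diagram. -/
def addRow (a : Fin r) (x : Fin r → YoungDiagram) : Fin r → YoungDiagram :=
  Function.update x a ((x a).addCell 0 (addable_zero _))

lemma addable_colLen (μ : YoungDiagram) : μ.Addable (μ.colLen 0) := fun k hk => by
  have h1 := mem_iff_lt_rowLen.1 (mem_iff_lt_colLen.2 hk)
  have h2 : ¬ (μ.colLen 0, 0) ∈ μ := by rw [mem_iff_lt_colLen]; exact lt_irrefl _
  rw [mem_iff_lt_rowLen] at h2
  omega

/-- Add a cell to the first column of the `b`-th diagram. -/
def addCol (b : Fin r) (x : Fin r → YoungDiagram) : Fin r → YoungDiagram :=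
  Function.update x b ((x b).addCell ((x b).colLen 0) (addable_colLen _))

lemma covBy_addRow (x : Fin r → YoungDiagram) : x ⋖ addRow a x := covBy_iff.2 ⟨_, _, _, rfl⟩

lemma covBy_addCol (x : Fin r → YoungDiagram) : x ⋖ addCol b x := covBy_iff.2 ⟨_, _, _, rfl⟩

lemma addRow_injective : Function.Injective (addRow a) := fun x y h => by
  funext i
  have hi := congrFun h i
  unfold addRow at hi
  by_cases hia : i = a
  · subst hia
    simp only [Function.update_self] at hi
    refine eq_of_rowLen_eq fun k => ?_
    simpa [rowLen_addCell] using congrArg (fun ν => ν.rowLen k) hi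
  · simpa [hia] using hi

lemma addCol_injective : Function.Injective (addCol b) := fun x y h => by
  funext i
  have hi := congrFun h i
  unfold addCol at hi
  by_cases hib : i = b
  · subst hib
    simp only [Function.update_self] at hi
    have hc : (x i).colLen 0 = (y i).colLen 0 := by
      simpa [colLen_zero_addCell] using congrArg (fun ν => ν.colLen 0) hi
    refine eq_of_rowLen_eq fun k => ?_
    simpa [rowLen_addCell, hc] using congrArg (fun ν => ν.rowLen k) hi
  · simpa [hib] using hi

lemma stat_update (x : Fin r → YoungDiagram) (i : Fin r) (k : ℕ) (h : (x i).Addable k) :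
    stat a b (Function.update x i ((x i).addCell k h)) = stat a b x +
      (if i = a ∧ k = 0 then 1 else 0) - if i = b ∧ k = (x b).colLen 0 then 1 else 0 := by
  have h1 : (Function.update x i ((x i).addCell k h) a).rowLen 0 =
      (x a).rowLen 0 + if i = a ∧ k = 0 then 1 else 0 := by
    by_cases hi : i = a
    · subst hi; simp [rowLen_addCell, eq_comm]
    · simp [hi, Ne.symm hi]
  have h2 : (Function.update x i ((x i).addCell k h) b).colLen 0 =
      (x b).colLen 0 + if i = b ∧ k = (x b).colLen 0 then 1 else 0 := by
    by_cases hi : i = b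
    · subst hi; simp [colLen_zero_addCell]
    · simp [hi, Ne.symm hi]
  unfold stat
  rw [h1, h2]
  push_cast
  ring

/-- The condition under which the first row of the `a`-th diagram and the first column of the
`b`-th diagram may be extended independently. -/
def Good (a b : Fin r) (n : ℕ) : Prop := a = b → 0 < n

lemma Good.mono {m n : ℕ} (h : Good a b m) (hmn : m ≤ n) : Good a b n :=
  fun e => (h e).trans_le hmn

lemma colLen_ne_zero (hab : a = b → r = 1) {x : Fin r → YoungDiagram} (hx : Good a b (size x))
    (h : a = b) : (x b).colLen 0 ≠ 0 := by
  intro h0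
  have hr := hab h
  subst hr h
  have h1 : (0 : ℕ) < (x a).card := by
    have := hx rfl
    rwa [size, Fin.sum_univ_one, Subsingleton.elim 0 a] at this
  obtain ⟨⟨i, j⟩, hij⟩ := Finset.card_pos.1 h1
  have := mem_iff_lt_colLen.1 ((x a).up_left_mem le_rfl (Nat.zero_le j) (mem_cells _ |>.1 hij))
  omega

lemma stat_sub_one_le_of_covBy {x y : Fin r → YoungDiagram} (h : x ⋖ y) :
    stat a b x - 1 ≤ stat a b y := by
  obtain ⟨i, k, hk, rfl⟩ := covBy_iff.1 h
  rw [stat_update]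
  split_ifs <;> omega

lemma stat_le_add_one_of_covBy {x y : Fin r → YoungDiagram} (h : x ⋖ y) :
    stat a b y ≤ stat a b x + 1 := by
  obtain ⟨i, k, hk, rfl⟩ := covBy_iff.1 h
  rw [stat_update]
  split_ifs <;> omega

lemma eq_addCol_of_covBy {x y : Fin r → YoungDiagram} (h : x ⋖ y)
    (hs : stat a b y = stat a b x - 1) : y = addCol b x := by
  obtain ⟨i, k, hk, rfl⟩ := covBy_iff.1 h
  rw [stat_update] at hs
  have : i = b ∧ k = (x b).colLen 0 := by
    by_contra hne
    rw [if_neg hne] at hs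
    split_ifs at hs <;> omega
  obtain ⟨rfl, rfl⟩ := this
  rfl

lemma eq_addRow_of_covBy {x y : Fin r → YoungDiagram} (h : x ⋖ y)
    (hs : stat a b y = stat a b x + 1) : y = addRow a x := by
  obtain ⟨i, k, hk, rfl⟩ := covBy_iff.1 h
  rw [stat_update] at hs
  have : i = a ∧ k = 0 := by
    by_contra hne
    rw [if_neg hne] at hs
    split_ifs at hs <;> omega
  obtain ⟨rfl, rfl⟩ := this
  rfl

lemma good_of_covBy {x y : Fin r → YoungDiagram} (hab : a = b → r = 1) (h : x ⋖ y)
    (hs : stat a b y = stat a b x + 1) : Good a b (size x) := by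
  rintro rfl
  obtain ⟨i, k, hk, rfl⟩ := covBy_iff.1 h
  rw [stat_update] at hs
  by_contra hn
  have h0 : (x a).card = 0 := Nat.eq_zero_of_le_zero
    ((Finset.single_le_sum (f := fun j => (x j).card) (fun _ _ => Nat.zero_le _)
      (Finset.mem_univ a)).trans (not_lt.1 hn))
  have hc : (x a).colLen 0 = 0 := by
    have := Finset.card_le_card (Finset.filter_subset (fun c : ℕ × ℕ => c.snd = 0) (x a).cells)
    rw [colLen_eq_card]
    exact Nat.eq_zero_of_le_zero (this.trans h0.le)
  rw [hc] at hs
  split_ifs at hs <;> omega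

lemma stat_addRow (hab : a = b → r = 1) {x : Fin r → YoungDiagram} (hx : Good a b (size x)) :
    stat a b (addRow a x) = stat a b x + 1 := by
  rw [addRow, stat_update, if_pos ⟨rfl, rfl⟩, if_neg, sub_zero]
  rintro ⟨h, h0⟩
  exact colLen_ne_zero hab hx h h0.symm

lemma stat_addCol (hab : a = b → r = 1) {x : Fin r → YoungDiagram} (hx : Good a b (size x)) :
    stat a b (addCol b x) = stat a b x - 1 := by
  rw [addCol, stat_update, if_neg, add_zero, if_pos ⟨rfl, rfl⟩]
  rintro ⟨h, h0⟩
  exact colLen_ne_zero hab hx h.symm h0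

lemma size_addRow (x : Fin r → YoungDiagram) : size (addRow a x) = size x + 1 :=
  size_eq_of_covBy (covBy_addRow x)

lemma size_addCol (x : Fin r → YoungDiagram) : size (addCol b x) = size x + 1 :=
  size_eq_of_covBy (covBy_addCol x)

lemma addRow_addCol (hab : a = b → r = 1) {x : Fin r → YoungDiagram} (hx : Good a b (size x)) :
    addRow a (addCol b x) = addCol b (addRow a x) := by
  have hr := stat_addRow hab hx
  have hc := stat_addCol hab hx
  have hne : addCol b x ≠ addRow a x := fun h => by rw [h] at hc; omega
  obtain ⟨h1, h2⟩ := covBy_sup_of_covBy (covBy_addCol x) (covBy_addRow x) hne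
  have h3 := stat_le_add_one_of_covBy (a := a) (b := b) h1
  have h4 := stat_sub_one_le_of_covBy (a := a) (b := b) h2
  rw [← eq_addRow_of_covBy (a := a) (b := b) h1 (by omega),
    ← eq_addCol_of_covBy (a := a) (b := b) h2 (by omega)]

lemma exists_of_addRow_eq_addCol (hab : a = b → r = 1) {x y : Fin r → YoungDiagram}
    (hx : Good a b (size x)) (hy : Good a b (size y)) (h : addRow a x = addCol b y) :
    ∃ z, Good a b (size z) ∧ x = addCol b z ∧ y = addRow a z := by
  have hr := stat_addRow hab hx
  have hc := stat_addCol hab hy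
  rw [← h] at hc
  have hne : x ≠ y := fun e => by rw [e] at hr hc; omega
  obtain ⟨h1, h2⟩ := inf_covBy_of_covBy (covBy_addRow x) (h ▸ covBy_addCol y) hne
  have h3 := stat_sub_one_le_of_covBy (a := a) (b := b) h1
  have h4 := stat_le_add_one_of_covBy (a := a) (b := b) h2
  have hs : stat a b y = stat a b (x ⊓ y) + 1 := by omega
  exact ⟨x ⊓ y, good_of_covBy hab h2 hs, eq_addCol_of_covBy (a := a) (b := b) h1 (by omega),
    eq_addRow_of_covBy (a := a) (b := b) h2 hs⟩

end Statistic

section Cores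

variable {a b : Fin r}

/-- Tuples which arise from no smaller good tuple by `addRow` or `addCol`. -/
def IsCore (a b : Fin r) (x : Fin r → YoungDiagram) : Prop :=
  Good a b (size x) ∧ ∀ y, Good a b (size y) → addRow a y ≠ x ∧ addCol b y ≠ x

/-- Extend the first row of the `a`-th diagram by `k` cells and the first column of the `b`-th
diagram by `j` cells. -/
def extend (a b : Fin r) (x : Fin r → YoungDiagram) (k j : ℕ) : Fin r → YoungDiagram :=
  (addCol b)^[j] ((addRow a)^[k] x)

lemma extend_succ_col (x : Fin r → YoungDiagram) (k j : ℕ) :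
    extend a b x k (j + 1) = addCol b (extend a b x k j) :=
  Function.iterate_succ_apply' _ _ _

lemma size_extend (x : Fin r → YoungDiagram) (k j : ℕ) :
    size (extend a b x k j) = size x + k + j := by
  induction j with
  | zero =>
    induction k with
    | zero => rfl
    | succ k ih =>
      have : extend a b x (k + 1) 0 = addRow a (extend a b x k 0) :=
        Function.iterate_succ_apply' _ _ _
      rw [this, size_addRow, ih]
      ring
  | succ j ih => rw [extend_succ_col, size_addCol, ih]; ring

lemma good_extend {x : Fin r → YoungDiagram} (hx : Good a b (size x)) (k j : ℕ) :
    Good a b (size (extend a b x k j)) :=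
  hx.mono (by rw [size_extend]; omega)

lemma extend_succ_row (hab : a = b → r = 1) {x : Fin r → YoungDiagram}
    (hx : Good a b (size x)) (k j : ℕ) :
    extend a b x (k + 1) j = addRow a (extend a b x k j) := by
  induction j with
  | zero => exact Function.iterate_succ_apply' _ _ _
  | succ j ih => rw [extend_succ_col, extend_succ_col, ih, addRow_addCol hab (good_extend hx k j)]

lemma exists_extend_eq (hab : a = b → r = 1) (x : Fin r → YoungDiagram)
    (hx : Good a b (size x)) : ∃ y k j, IsCore a b y ∧ extend a b y k j = x := by
  induction hn : size x generalizing x with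
  | zero => exact ⟨x, 0, 0, ⟨hx, fun y _ =>
      ⟨fun h => by rw [← h, size_addRow] at hn; omega,
        fun h => by rw [← h, size_addCol] at hn; omega⟩⟩, rfl⟩
  | succ n ih =>
    by_cases hrow : ∃ y, Good a b (size y) ∧ addRow a y = x
    · obtain ⟨y, hy, rfl⟩ := hrow
      rw [size_addRow] at hn
      obtain ⟨z, k, j, hz, rfl⟩ := ih y hy (by omega)
      exact ⟨z, k + 1, j, hz, extend_succ_row hab hz.1 k j⟩
    · by_cases hcol : ∃ y, Good a b (size y) ∧ addCol b y = x
      · obtain ⟨y, hy, rfl⟩ := hcol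
        rw [size_addCol] at hn
        obtain ⟨z, k, j, hz, rfl⟩ := ih y hy (by omega)
        exact ⟨z, k, j + 1, hz, extend_succ_col z k j⟩
      · push Not at hrow hcol
        exact ⟨x, 0, 0, ⟨hx, fun y hy => ⟨hrow y hy, hcol y hy⟩⟩, rfl⟩

lemma addRow_ne_extend (hab : a = b → r = 1) {x : Fin r → YoungDiagram} (hx : IsCore a b x)
    (j : ℕ) {y : Fin r → YoungDiagram} (hy : Good a b (size y)) :
    addRow a y ≠ extend a b x 0 j := by
  induction j generalizing y with
  | zero => exact (hx.2 y hy).1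
  | succ j ih =>
    rw [extend_succ_col]
    intro h
    obtain ⟨z, hz, -, h2⟩ := exists_of_addRow_eq_addCol hab hy (good_extend hx.1 0 j) h
    exact ih hz h2.symm

lemma extend_injective (hab : a = b → r = 1) {x y : Fin r → YoungDiagram} (hx : IsCore a b x)
    (hy : IsCore a b y) {k j k' j' : ℕ} (h : extend a b x k j = extend a b y k' j') :
    x = y ∧ k = k' ∧ j = j' := by
  induction k generalizing k' with
  | zero =>
    cases k' with
    | zero =>
      induction j generalizing j' with
      | zero =>
        cases j' with
        | zero => exact ⟨h, rfl, rfl⟩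
        | succ j' =>
          rw [extend_succ_col] at h
          exact absurd h.symm (hx.2 _ (good_extend hy.1 0 j')).2
      | succ j ih =>
        cases j' with
        | zero =>
          rw [extend_succ_col] at h
          exact absurd h (hy.2 _ (good_extend hx.1 0 j)).2
        | succ j' =>
          rw [extend_succ_col, extend_succ_col] at h
          obtain ⟨h1, -, h2⟩ := ih (addCol_injective h)
          exact ⟨h1, rfl, by omega⟩
    | succ k' =>
      rw [extend_succ_row hab hy.1] at h
      exact absurd h.symm (addRow_ne_extend hab hx j (good_extend hy.1 k' j'))
  | succ k ih =>
    cases k' with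
    | zero =>
      rw [extend_succ_row hab hx.1] at h
      exact absurd h (addRow_ne_extend hab hy j' (good_extend hx.1 k j))
    | succ k' =>
      rw [extend_succ_row hab hx.1, extend_succ_row hab hy.1] at h
      obtain ⟨h1, h2, h3⟩ := ih (addRow_injective h)
      exact ⟨h1, by omega, h3⟩

/-- The cores of rank at most `n`. -/
abbrev Core (a b : Fin r) (n : ℕ) : Type := {x : Fin r → YoungDiagram // IsCore a b x ∧ size x ≤ n}

instance (n : ℕ) : Finite (Core a b n) := by
  refine (((Set.finite_le_nat n).biUnion fun m _ => finite_size_eq m).subset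
    fun x hx => ?_ : {x : Fin r → YoungDiagram | IsCore a b x ∧ size x ≤ n}.Finite)
  exact Set.mem_biUnion (hx.2 : size x ∈ {m | m ≤ n}) rfl

lemma card_sigma_core (hab : a = b → r = 1) {n : ℕ} (hn : Good a b n) :
    Nat.card (Σ x : Core a b n, Fin (n - size x.1 + 1)) = Nat.card (YLevel r n) := by
  refine Nat.card_congr (Equiv.ofBijective (fun p : Σ x : Core a b n, Fin (n - size x.1 + 1) =>
    (⟨extend a b p.1.1 (n - size p.1.1 - p.2) p.2, ?_⟩ : YLevel r n)) ⟨?_, ?_⟩)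
  · have h1 := p.1.2.2
    have h2 := p.2.2
    have h3 := size_extend (a := a) (b := b) p.1.1 (n - size p.1.1 - p.2) p.2
    unfold size at h1 h2 h3 ⊢
    omega
  · rintro ⟨⟨x, hx, hxn⟩, j, hj⟩ ⟨⟨y, hy, hyn⟩, j', hj'⟩ h
    obtain ⟨rfl, -, rfl⟩ := extend_injective hab hx hy (Subtype.ext_iff.1 h)
    rfl
  · rintro ⟨y, hy⟩
    change size y = n at hy
    obtain ⟨x, k, j, hx, rfl⟩ := exists_extend_eq hab y (hy ▸ hn)
    rw [size_extend] at hy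
    refine ⟨⟨⟨x, hx, by omega⟩, ⟨j, by dsimp only; omega⟩⟩, Subtype.ext ?_⟩
    dsimp only
    congr 1
    omega

end Cores

section Operators

variable {a b : Fin r} {R : Type*} [CommRing R]

/-- The up map. -/
noncomputable def up (R : Type*) [CommRing R] (r : ℕ) :
    Module.End R ((Fin r → YoungDiagram) →₀ R) :=
  Finsupp.linearCombination R fun x =>
    ∑ y ∈ (finite_upperCovers x).toFinset, Finsupp.single y (1 : R)

/-- The down map. -/
noncomputable def down (R : Type*) [CommRing R] (r : ℕ) :
    Module.End R ((Fin r → YoungDiagram) →₀ R) :=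
  Finsupp.linearCombination R fun x =>
    ∑ y ∈ (finite_lowerCovers x).toFinset, Finsupp.single y (1 : R)

lemma up_single (x : Fin r → YoungDiagram) : up R r (Finsupp.single x 1) =
    ∑ y ∈ (finite_upperCovers x).toFinset, Finsupp.single y (1 : R) := by
  simp [up]

lemma down_single (x : Fin r → YoungDiagram) : down R r (Finsupp.single x 1) =
    ∑ y ∈ (finite_lowerCovers x).toFinset, Finsupp.single y (1 : R) := by
  simp [down]

lemma up_single_apply (x z : Fin r → YoungDiagram) [Decidable (x ⋖ z)] :
    up R r (Finsupp.single x 1) z = if x ⋖ z then 1 else 0 := by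
  classical
  rw [up_single, Finsupp.finsetSum_apply]
  simp [Finsupp.single_apply]

lemma down_single_apply (x z : Fin r → YoungDiagram) [Decidable (z ⋖ x)] :
    down R r (Finsupp.single x 1) z = if z ⋖ x then 1 else 0 := by
  classical
  rw [down_single, Finsupp.finsetSum_apply]
  simp [Finsupp.single_apply]

lemma down_up_single_apply (x z : Fin r → YoungDiagram) :
    down R r (up R r (Finsupp.single x 1)) z = ({y | x ⋖ y ∧ z ⋖ y}.ncard : R) := by
  classical
  rw [up_single, map_sum, Finsupp.finsetSum_apply]
  simp_rw [down_single_apply]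
  rw [Finset.sum_boole, ← Set.ncard_coe_finset]
  congr 2
  ext y
  simp

lemma up_down_single_apply (x z : Fin r → YoungDiagram) :
    up R r (down R r (Finsupp.single x 1)) z = ({y | y ⋖ x ∧ y ⋖ z}.ncard : R) := by
  classical
  rw [down_single, map_sum, Finsupp.finsetSum_apply]
  simp_rw [up_single_apply]
  rw [Finset.sum_boole, ← Set.ncard_coe_finset]
  congr 2
  ext y
  simp

lemma down_mul_up : down R r * up R r = up R r * down R r + (r : Module.End R _) := by
  refine Finsupp.lhom_ext' fun x => LinearMap.ext_ring (Finsupp.ext fun z => ?_)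
  simp only [LinearMap.comp_apply, Finsupp.lsingle_apply, Module.End.mul_apply,
    LinearMap.add_apply, Finsupp.add_apply, Module.End.natCast_apply, Finsupp.smul_apply,
    down_up_single_apply, up_down_single_apply]
  by_cases hxz : x = z
  · subst hxz
    simp only [and_self, ncard_upperCovers, Finsupp.single_eq_same]
    simp
  · rw [ncard_common_covers hxz]
    simp [hxz]

/-- The operators `U^j D^j`. -/
noncomputable def updown (R : Type*) [CommRing R] (r j : ℕ) :
    Module.End R ((Fin r → YoungDiagram) →₀ R) :=
  up R r ^ j * down R r ^ j

lemma up_mul_down_mul_up_pow (j : ℕ) : up R r * down R r * up R r ^ j =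
    up R r ^ (j + 1) * down R r + ((r * j : ℕ) : Module.End R _) * up R r ^ j := by
  induction j with
  | zero => simp
  | succ j ih =>
    have h : up R r * down R r * up R r ^ (j + 1) = up R r * down R r * up R r ^ j * up R r := by
      rw [pow_succ]; noncomm_ring
    rw [h, ih, add_mul, mul_assoc, down_mul_up, mul_add, ← mul_assoc, ← pow_succ, add_assoc]
    congr 1
    rw [mul_assoc, ← pow_succ, (Nat.cast_commute r (up R r ^ (j + 1))).eq.symm, ← add_mul]
    congr 1
    push_cast
    noncomm_ring

lemma up_mul_down_mul_updown (j : ℕ) : up R r * down R r * updown R r j =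
    updown R r (j + 1) + ((r * j : ℕ) : Module.End R _) * updown R r j := by
  unfold updown
  rw [← mul_assoc, up_mul_down_mul_up_pow, add_mul, mul_assoc, ← pow_succ', mul_assoc]

lemma down_mul_up_mul_updown (j : ℕ) : down R r * up R r * updown R r j =
    updown R r (j + 1) + ((r * (j + 1) : ℕ) : Module.End R _) * updown R r j := by
  rw [down_mul_up, add_mul, up_mul_down_mul_updown]
  push_cast
  noncomm_ring

lemma updown_updown_mem_span (i j : ℕ) (f : (Fin r → YoungDiagram) →₀ R) :
    updown R r j (updown R r i f) ∈
      Submodule.span R ((fun k => updown R r k f) '' Set.Iic (i + j)) := by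
  induction j with
  | zero => exact Submodule.subset_span ⟨i, by simp, by simp [updown]⟩
  | succ j ih =>
    have h := LinearMap.congr_fun (up_mul_down_mul_updown (R := R) (r := r) j) (updown R r i f)
    have h : updown R r (j + 1) (updown R r i f) =
        (up R r * down R r) (updown R r j (updown R r i f)) -
          (r * j) • updown R r j (updown R r i f) := by
      rw [eq_sub_iff_add_eq]
      exact h.symm
    have hle : Submodule.span R ((fun k => updown R r k f) '' Set.Iic (i + j)) ≤
        Submodule.span R ((fun k => updown R r k f) '' Set.Iic (i + (j + 1))) :=
      Submodule.span_mono (Set.image_mono (Set.Iic_subset_Iic.2 (by omega)))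
    rw [h]
    refine Submodule.sub_mem _ ?_ (nsmul_mem (hle ih) _)
    have hmap : Submodule.span R ((fun k => updown R r k f) '' Set.Iic (i + j)) ≤
        (Submodule.span R ((fun k => updown R r k f) '' Set.Iic (i + (j + 1)))).comap
          (up R r * down R r) := by
      rw [Submodule.span_le]
      rintro _ ⟨k, hk, rfl⟩
      have hk : k ≤ i + j := hk
      have h := LinearMap.congr_fun (up_mul_down_mul_updown (R := R) (r := r) k) f
      rw [SetLike.mem_coe, Submodule.mem_comap]
      change (up R r * down R r) (updown R r k f) =
        updown R r (k + 1) f + (r * k) • updown R r k f at h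
      rw [h]
      exact Submodule.add_mem _
        (Submodule.subset_span (Set.mem_image_of_mem _ (Set.mem_Iic.2 (by omega))))
        (nsmul_mem (Submodule.subset_span (Set.mem_image_of_mem _ (Set.mem_Iic.2 (by omega)))) _)
    exact hmap ih

end Operators

section Filtration

variable {a b : Fin r} {R : Type*} [CommRing R]

/-- The span of the tuples of size `n` on which `stat` is at least `t`. -/
noncomputable def high (R : Type*) [CommRing R] (a b : Fin r) (n : ℕ) (t : ℤ) :
    Submodule R ((Fin r → YoungDiagram) →₀ R) :=
  Submodule.span R ((fun x => Finsupp.single x 1) '' {x | size x = n ∧ t ≤ stat a b x})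

lemma single_mem_high {x : Fin r → YoungDiagram} {n : ℕ} {t : ℤ} (hn : size x = n)
    (ht : t ≤ stat a b x) : Finsupp.single x 1 ∈ high R a b n t :=
  Submodule.subset_span ⟨x, ⟨hn, ht⟩, rfl⟩

lemma high_le {n : ℕ} {t : ℤ} {S : Submodule R ((Fin r → YoungDiagram) →₀ R)}
    (h : ∀ x, size x = n → t ≤ stat a b x → Finsupp.single x 1 ∈ S) : high R a b n t ≤ S := by
  refine Submodule.span_le.2 ?_
  rintro _ ⟨x, hx, rfl⟩
  exact h x hx.1 hx.2

lemma up_mem_high {n : ℕ} {t : ℤ} {f : (Fin r → YoungDiagram) →₀ R} (hf : f ∈ high R a b n t) :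
    up R r f ∈ high R a b (n + 1) (t - 1) := by
  have h : high R a b n t ≤ (high R a b (n + 1) (t - 1)).comap (up R r) :=
    high_le fun x hn ht => by
      rw [Submodule.mem_comap, up_single]
      refine Submodule.sum_mem _ fun y hy => ?_
      have hxy : x ⋖ y := by simpa using hy
      have hs := stat_sub_one_le_of_covBy (a := a) (b := b) hxy
      exact single_mem_high (by rw [size_eq_of_covBy hxy, hn]) (by omega)
  exact h hf

lemma down_mem_high {n : ℕ} {t : ℤ} {f : (Fin r → YoungDiagram) →₀ R}
    (hf : f ∈ high R a b (n + 1) t) : down R r f ∈ high R a b n (t - 1) := by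
  have h : high R a b (n + 1) t ≤ (high R a b n (t - 1)).comap (down R r) :=
    high_le fun x hn ht => by
      rw [Submodule.mem_comap, down_single]
      refine Submodule.sum_mem _ fun y hy => ?_
      have hyx : y ⋖ x := by simpa using hy
      have hs := stat_le_add_one_of_covBy (a := a) (b := b) hyx
      have hz := size_eq_of_covBy hyx
      exact single_mem_high (by omega) (by omega)
  exact h hf

/-- `f` is homogeneous, and equal to `x` up to tuples with larger `stat`. -/
def Lead (a b : Fin r) (f : (Fin r → YoungDiagram) →₀ R) (x : Fin r → YoungDiagram) : Prop :=
  f - Finsupp.single x 1 ∈ high R a b (size x) (stat a b x + 1)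

lemma Lead.up (hab : a = b → r = 1) {f : (Fin r → YoungDiagram) →₀ R}
    {x : Fin r → YoungDiagram} (hf : Lead a b f x) (hx : Good a b (size x)) :
    Lead a b (up R r f) (addCol b x) := by
  classical
  unfold Lead
  have hs := stat_addCol hab hx
  have h : YoungTuple.up R r f - Finsupp.single (addCol b x) 1 =
      YoungTuple.up R r (f - Finsupp.single x 1) +
        ∑ y ∈ (finite_upperCovers x).toFinset.erase (addCol b x), Finsupp.single y (1 : R) := by
    rw [map_sub, up_single, ← Finset.add_sum_erase _ _
      ((finite_upperCovers x).mem_toFinset.2 (covBy_addCol (b := b) x))]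
    abel
  rw [h, hs, size_addCol, sub_add_cancel]
  refine Submodule.add_mem _ (by simpa using up_mem_high hf)
    (Submodule.sum_mem _ fun y hy => ?_)
  have hxy : x ⋖ y := by simpa using (Finset.mem_erase.1 hy).2
  refine single_mem_high (size_eq_of_covBy hxy) ?_
  have h1 := stat_sub_one_le_of_covBy (a := a) (b := b) hxy
  by_contra! h2
  exact (Finset.mem_erase.1 hy).1 (eq_addCol_of_covBy hxy (by omega : stat a b y = _))

lemma Lead.down (hab : a = b → r = 1) {f : (Fin r → YoungDiagram) →₀ R}
    {x : Fin r → YoungDiagram} (hf : Lead a b f (addRow a x)) (hx : Good a b (size x)) :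
    Lead a b (down R r f) x := by
  classical
  unfold Lead at hf ⊢
  have hs := stat_addRow hab hx
  have h : YoungTuple.down R r f - Finsupp.single x 1 =
      YoungTuple.down R r (f - Finsupp.single (addRow a x) 1) +
        ∑ y ∈ (finite_lowerCovers (addRow a x)).toFinset.erase x, Finsupp.single y (1 : R) := by
    rw [map_sub, down_single, ← Finset.add_sum_erase _ _
      ((finite_lowerCovers (addRow a x)).mem_toFinset.2 (covBy_addRow (a := a) x))]
    abel
  rw [hs, size_addRow] at hf
  rw [h]
  refine Submodule.add_mem _ (by simpa using down_mem_high hf)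
    (Submodule.sum_mem _ fun y hy => ?_)
  have hxy : y ⋖ addRow a x := by simpa using (Finset.mem_erase.1 hy).2
  have hz := size_eq_of_covBy hxy
  rw [size_addRow] at hz
  refine single_mem_high (by omega) ?_
  have h1 := stat_le_add_one_of_covBy (a := a) (b := b) hxy
  by_contra! h2
  exact (Finset.mem_erase.1 hy).1
    (addRow_injective (eq_addRow_of_covBy hxy (by omega : stat a b _ = stat a b y + 1))).symm

lemma Lead.up_pow (hab : a = b → r = 1) {f : (Fin r → YoungDiagram) →₀ R}
    {x : Fin r → YoungDiagram} (hx : Good a b (size x)) {k : ℕ}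
    (hf : Lead a b f (extend a b x k 0)) (m : ℕ) :
    Lead a b ((YoungTuple.up R r ^ m) f) (extend a b x k m) := by
  induction m with
  | zero => exact hf
  | succ m ih =>
    rw [pow_succ', extend_succ_col]
    exact ih.up hab (good_extend hx k m)

lemma Lead.down_pow (hab : a = b → r = 1) {f : (Fin r → YoungDiagram) →₀ R}
    {x : Fin r → YoungDiagram} (hx : Good a b (size x)) {k j : ℕ} (m : ℕ)
    (hf : Lead a b f (extend a b x (k + m) j)) :
    Lead a b ((YoungTuple.down R r ^ m) f) (extend a b x k j) := by
  induction m generalizing f with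
  | zero => exact hf
  | succ m ih =>
    rw [pow_succ]
    refine ih (f := YoungTuple.down R r f) (Lead.down hab ?_ (good_extend hx (k + m) j))
    rw [← extend_succ_row hab hx]
    exact hf

lemma lead_single (x : Fin r → YoungDiagram) : Lead a b (Finsupp.single x (1 : R)) x := by
  simp [Lead]

lemma lead_down_pow_updown (hab : a = b → r = 1) {x : Fin r → YoungDiagram}
    (hx : Good a b (size x)) (d k j : ℕ) :
    Lead a b ((down R r ^ d) (updown R r j (Finsupp.single (extend a b x (k + d + j) 0) 1)))
      (extend a b x k j) :=
  (((lead_single _).down_pow hab hx j).up_pow hab hx j).down_pow hab hx d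

/-- A submodule containing a homogeneous element with each leading tuple of size `n` contains all
tuples of size `n`. -/
lemma single_mem_of_lead {n : ℕ} {S : Submodule R ((Fin r → YoungDiagram) →₀ R)}
    (h : ∀ x, size x = n → ∃ g ∈ S, Lead a b g x) {x : Fin r → YoungDiagram} (hx : size x = n) :
    Finsupp.single x 1 ∈ S := by
  obtain ⟨B, hB⟩ := ((finite_size_eq (r := r) n).image (stat a b)).bddAbove
  have hB : ∀ x, size x = n → stat a b x ≤ B := fun x hx => hB ⟨x, hx, rfl⟩
  have key : ∀ m : ℕ, high R a b n (B + 1 - m) ≤ S := by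
    intro m
    induction m with
    | zero =>
      refine high_le fun x hn ht => ?_
      have := hB x hn
      push_cast at ht
      omega
    | succ m ih =>
      refine high_le fun x hn ht => ?_
      obtain ⟨g, hg, hl⟩ := h x hn
      have hle : high R a b n (stat a b x + 1) ≤ high R a b n (B + 1 - m) :=
        high_le fun y hy hs => single_mem_high hy (by push_cast at ht; omega)
      subst hn
      simpa using S.sub_mem hg (ih (hle hl))
  refine key (B + 1 - stat a b x).toNat (single_mem_high hx ?_)
  have := hB x hx
  omega

end Filtration

section Span

variable {a b : Fin r} {R : Type*} [CommRing R]

/-- The span of the tuples of size `n`. -/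
noncomputable def level (R : Type*) [CommRing R] (r n : ℕ) :
    Submodule R ((Fin r → YoungDiagram) →₀ R) :=
  Submodule.span R ((fun x => Finsupp.single x 1) '' {x | size x = n})

lemma single_mem_level {n : ℕ} {x : Fin r → YoungDiagram} (h : size x = n) :
    Finsupp.single x 1 ∈ level R r n :=
  Submodule.subset_span ⟨x, h, rfl⟩

lemma level_le {n : ℕ} {S : Submodule R ((Fin r → YoungDiagram) →₀ R)}
    (h : ∀ x, size x = n → Finsupp.single x 1 ∈ S) : level R r n ≤ S := by
  refine Submodule.span_le.2 ?_
  rintro _ ⟨x, hx, rfl⟩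
  exact h x hx

lemma down_mem_level {n : ℕ} {f : (Fin r → YoungDiagram) →₀ R} (hf : f ∈ level R r (n + 1)) :
    down R r f ∈ level R r n := by
  have h : level R r (n + 1) ≤ (level R r n).comap (down R r) := level_le fun x hx => by
    rw [Submodule.mem_comap, down_single]
    refine Submodule.sum_mem _ fun y hy => single_mem_level ?_
    have := size_eq_of_covBy (show y ⋖ x by simpa using hy)
    omega
  exact h hf

lemma up_mem_level {n : ℕ} {f : (Fin r → YoungDiagram) →₀ R} (hf : f ∈ level R r n) :
    up R r f ∈ level R r (n + 1) := by
  have h : level R r n ≤ (level R r (n + 1)).comap (up R r) := level_le fun x hx => by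
    rw [Submodule.mem_comap, up_single]
    refine Submodule.sum_mem _ fun y hy => single_mem_level ?_
    have := size_eq_of_covBy (show x ⋖ y by simpa using hy)
    omega
  exact h hf

lemma down_pow_mem_level {n m : ℕ} {f : (Fin r → YoungDiagram) →₀ R}
    (hf : f ∈ level R r (n + m)) : (down R r ^ m) f ∈ level R r n := by
  induction m generalizing f with
  | zero => exact hf
  | succ m ih => exact ih (down_mem_level hf)

lemma up_pow_mem_level {n m : ℕ} {f : (Fin r → YoungDiagram) →₀ R}
    (hf : f ∈ level R r n) : (up R r ^ m) f ∈ level R r (n + m) := by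
  induction m with
  | zero => exact hf
  | succ m ih =>
    rw [pow_succ']
    exact up_mem_level ih

lemma updown_mem_level {n j : ℕ} (hj : j ≤ n) {f : (Fin r → YoungDiagram) →₀ R}
    (hf : f ∈ level R r n) : updown R r j f ∈ level R r n := by
  obtain ⟨m, rfl⟩ := Nat.exists_eq_add_of_le' hj
  exact up_pow_mem_level (down_pow_mem_level hf)

lemma down_eq_zero {f : (Fin r → YoungDiagram) →₀ R} (hf : f ∈ level R r 0) :
    down R r f = 0 := by
  have h : level R r 0 ≤ LinearMap.ker (down R r) := level_le fun x hx => by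
    rw [LinearMap.mem_ker, down_single]
    refine Finset.sum_eq_zero fun y hy => ?_
    have := size_eq_of_covBy (show y ⋖ x by simpa using hy)
    omega
  exact h hf

/-- The core extended to size `n` by enlarging the first row. -/
noncomputable def topVec (R : Type*) [CommRing R] (a b : Fin r) (n : ℕ)
    (x : Fin r → YoungDiagram) : (Fin r → YoungDiagram) →₀ R :=
  Finsupp.single (extend a b x (n - size x) 0) 1

lemma topVec_mem_level {n : ℕ} {x : Fin r → YoungDiagram} (h : size x ≤ n) :
    topVec R a b n x ∈ level R r n :=
  single_mem_level (by rw [size_extend]; omega)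

lemma exists_lead_topVec (hab : a = b → r = 1) {n m : ℕ} (hmn : m ≤ n) (hm : Good a b m)
    {x : Fin r → YoungDiagram} (hx : size x = m) : ∃ y j, IsCore a b y ∧ size y + j ≤ m ∧
      Lead a b ((down R r ^ (n - m)) (updown R r j (topVec R a b n y))) x := by
  subst hx
  obtain ⟨y, k, j, hy, rfl⟩ := exists_extend_eq hab x hm
  rw [size_extend] at hmn ⊢
  refine ⟨y, j, hy, by omega, ?_⟩
  have h := lead_down_pow_updown (R := R) hab hy.1 (n - (size y + k + j)) k j
  rwa [show k + (n - (size y + k + j)) + j = n - size y by omega] at h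

lemma exists_correction (hab : a = b → r = 1) {n : ℕ} {x : Fin r → YoungDiagram}
    (hxn : size x ≤ n) : ∃ f ∈ level R r n,
      topVec R a b n x - f ∈ Submodule.span R {g | ∃ y j, IsCore a b y ∧ size y + j < size x ∧
        g = updown R r j (topVec R a b n y)} ∧
      (¬(a = b ∧ size x = 1) → (down R r ^ (n - size x + 1)) f = 0) := by
  have hlev := topVec_mem_level (R := R) (a := a) (b := b) hxn
  by_cases hs : a = b ∧ size x = 1
  · exact ⟨_, hlev, by simp, fun h => absurd hs h⟩
  obtain h0 | ⟨m, hm⟩ : size x = 0 ∨ ∃ m, size x = m + 1 := by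
    cases size x <;> simp
  · refine ⟨_, hlev, by simp, fun _ => ?_⟩
    rw [h0, tsub_zero, pow_succ']
    exact down_eq_zero (down_pow_mem_level (by simpa using hlev))
  set P := Submodule.span R {g | ∃ y j, IsCore a b y ∧ size y + j < size x ∧
    g = updown R r j (topVec R a b n y)} with hP
  have hPlev : P ≤ level R r n := by
    refine Submodule.span_le.2 ?_
    rintro _ ⟨y, j, -, hj, rfl⟩
    exact updown_mem_level (by omega) (topVec_mem_level (by omega))
  have hgood : Good a b m := fun h => by
    by_contra
    exact hs ⟨h, by omega⟩
  have hmem : (down R r ^ (n - m)) (topVec R a b n x) ∈ P.map (down R r ^ (n - m)) := by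
    refine level_le (fun z hz => single_mem_of_lead (a := a) (b := b) (fun y hy => ?_) hz)
      (down_pow_mem_level (n := m) (m := n - m) (by rwa [Nat.add_sub_of_le (by omega)]))
    obtain ⟨w, j, hw, hj, hl⟩ := exists_lead_topVec (R := R) (n := n) hab (by omega) hgood hy
    exact ⟨_, Submodule.mem_map_of_mem
      (Submodule.subset_span ⟨w, j, hw, by omega, rfl⟩), hl⟩
  obtain ⟨c, hc, hce⟩ := hmem
  refine ⟨topVec R a b n x - c, Submodule.sub_mem _ hlev (hPlev hc), by simpa using hc,
    fun _ => ?_⟩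
  rw [show n - size x + 1 = n - m by omega, map_sub, hce, sub_self]

/-- A generator of a chain of images under the `updown` operators. -/
noncomputable def coreVec (R : Type*) [CommRing R] (hab : a = b → r = 1) {n : ℕ}
    (x : Core a b n) : (Fin r → YoungDiagram) →₀ R :=
  (exists_correction (R := R) hab x.2.2).choose

lemma coreVec_mem_level (hab : a = b → r = 1) {n : ℕ} (x : Core a b n) :
    coreVec R hab x ∈ level R r n :=
  (exists_correction (R := R) hab x.2.2).choose_spec.1

lemma topVec_sub_coreVec_mem (hab : a = b → r = 1) {n : ℕ} (x : Core a b n) :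
    topVec R a b n x.1 - coreVec R hab x ∈ Submodule.span R
      {g | ∃ y j, IsCore a b y ∧ size y + j < size x.1 ∧ g = updown R r j (topVec R a b n y)} :=
  (exists_correction (R := R) hab x.2.2).choose_spec.2.1

lemma updown_coreVec_eq_zero (hab : a = b → r = 1) {n : ℕ} (x : Core a b n)
    (hx : ¬(a = b ∧ size x.1 = 1)) : updown R r (n - size x.1 + 1) (coreVec R hab x) = 0 := by
  have h : (down R r ^ (n - size x.1 + 1)) (coreVec R hab x) = 0 :=
    (exists_correction (R := R) hab x.2.2).choose_spec.2.2 hx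
  rw [updown, Module.End.mul_apply, h, map_zero]

lemma single_mem_span_updown_coreVec (hab : a = b → r = 1) {n : ℕ} (hn : Good a b n)
    {x : Fin r → YoungDiagram} (hx : size x = n) : Finsupp.single x 1 ∈
      Submodule.span R {g | ∃ (y : Core a b n) (j : ℕ), size y.1 + j ≤ n ∧
        g = updown R r j (coreVec R hab y)} := by
  set T := Submodule.span R {g | ∃ (y : Core a b n) (j : ℕ), size y.1 + j ≤ n ∧
    g = updown R r j (coreVec R hab y)}
  have key : ∀ m (y : Fin r → YoungDiagram) (j : ℕ), IsCore a b y → size y = m →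
      size y + j ≤ n → updown R r j (topVec R a b n y) ∈ T := by
    intro m
    induction m using Nat.strong_induction_on with
    | _ m ih =>
      intro y j hy hym hj
      let y' : Core a b n := ⟨y, hy, by omega⟩
      rw [← sub_add_cancel (topVec R a b n y) (coreVec R hab y'), map_add]
      refine T.add_mem ?_ (Submodule.subset_span ⟨y', j, hj, rfl⟩)
      refine (Submodule.span_le.2 ?_ : _ ≤ T.comap (updown R r j)) (topVec_sub_coreVec_mem hab y')
      rintro _ ⟨z, i, hz, hi, rfl⟩
      have hi : size z + i < size y := hi
      refine (Submodule.span_le.2 ?_ : _ ≤ T) (updown_updown_mem_span i j _)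
      rintro _ ⟨k, hk, rfl⟩
      have hk : k ≤ i + j := hk
      exact ih (size z) (by omega) z k hz rfl (by omega)
  refine single_mem_of_lead (a := a) (b := b) (fun y hy => ?_) hx
  obtain ⟨w, j, hw, hj, hl⟩ := exists_lead_topVec (R := R) (n := n) hab le_rfl hn hy
  rw [Nat.sub_self, pow_zero] at hl
  exact ⟨_, key _ w j hw rfl hj, hl⟩

lemma up_down_eq_self {f : (Fin 1 → YoungDiagram) →₀ R} (hf : f ∈ level R 1 1) :
    up R 1 (down R 1 f) = f := by
  have h : level R 1 1 ≤ LinearMap.eqLocus (up R 1 * down R 1) 1 := level_le fun x hx => by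
    have hcov : ∀ z : Fin 1 → YoungDiagram, size z = 1 → ⊥ ⋖ z := fun z hz => by
      refine ⟨bot_lt_iff_ne_bot.2 fun h => ?_, fun c h1 h2 => ?_⟩
      · rw [h, size_bot] at hz
        omega
      · have := size_strictMono h1
        have := size_strictMono h2
        omega
    have hlow : (finite_lowerCovers x).toFinset = {⊥} := by
      ext z
      simp only [Set.Finite.mem_toFinset, Set.mem_ofPred_eq, Finset.mem_singleton]
      refine ⟨fun h => eq_bot_of_size_eq_zero ?_, fun h => h ▸ hcov x hx⟩
      have := size_eq_of_covBy h
      omega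
    have hbot : {y : Fin 1 → YoungDiagram | y ⋖ ⊥} = ∅ :=
      Set.eq_empty_of_forall_notMem fun y (hy : y ⋖ ⊥) => not_lt_bot hy.lt
    have hup : (finite_upperCovers (⊥ : Fin 1 → YoungDiagram)).toFinset = {x} := by
      have hcard := ncard_upperCovers (⊥ : Fin 1 → YoungDiagram)
      rw [hbot, Set.ncard_empty, zero_add] at hcard
      obtain ⟨y, hy⟩ := Set.ncard_eq_one.1 hcard
      have hxy : x ∈ {z : Fin 1 → YoungDiagram | ⊥ ⋖ z} := hcov x hx
      rw [hy, Set.mem_singleton_iff] at hxy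
      rw [hxy]
      ext z
      rw [Set.Finite.mem_toFinset, hy, Set.mem_singleton_iff, Finset.mem_singleton]
    rw [LinearMap.mem_eqLocus, Module.End.mul_apply, down_single, hlow, Finset.sum_singleton,
      up_single, hup, Finset.sum_singleton, Module.End.one_apply]
  exact h hf

lemma updown_succ_eq_updown (hr : r = 1) {n : ℕ} {f : (Fin r → YoungDiagram) →₀ R}
    (hf : f ∈ level R r (n + 1)) : updown R r (n + 1) f = updown R r n f := by
  subst hr
  rw [updown, pow_succ, pow_succ']
  exact congrArg (up R 1 ^ n) (up_down_eq_self (down_pow_mem_level (by rwa [add_comm])))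

end Span

end YoungTuple

namespace Matrix

section SmithNormalForm

variable {ι κ R : Type*} [Fintype κ] [CommRing R]

lemma isUnit_of_span_eq_top {m : ℕ} (eι : ι ≃ Fin m) (eκ : Fin m ≃ κ) {e : κ → ι → R}
    (he : Submodule.span R (Set.range e) = ⊤) :
    IsUnit (Matrix.of fun i j => e (eκ j) (eι.symm i) : Matrix (Fin m) (Fin m) R) := by
  rw [← mulVec_surjective_iff_isUnit]
  intro v
  have hv : v ∘ eι ∈ Submodule.span R (Set.range e) := he ▸ Submodule.mem_top
  obtain ⟨c, hc⟩ := (Submodule.mem_span_range_iff_exists_fun R).1 hv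
  refine ⟨c ∘ eκ, funext fun i => ?_⟩
  have h := congrFun hc (eι.symm i)
  rw [Function.comp_apply, eι.apply_symm_apply, Finset.sum_apply, ← Equiv.sum_comp eκ] at h
  rw [← h]
  simp [mulVec, dotProduct, mul_comm]

variable [Fintype ι]

/-- A square matrix which is diagonal with respect to a pair of bases, with diagonal entries
forming a divisibility chain when sorted by `key`, has Smith normal form. -/
lemma hasSNF'_of_mulVec_eq_smul (A : Matrix ι ι R) {e e' : κ → ι → R}
    (hcard : Fintype.card κ = Fintype.card ι) (he : Submodule.span R (Set.range e) = ⊤)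
    (he' : Submodule.span R (Set.range e') = ⊤) {s : κ → R}
    (hA : ∀ k, A *ᵥ e k = s k • e' k) (key : κ → ℕ)
    (hs : ∀ k k', key k ≤ key k' → s k ∣ s k') : A.HasSNF' := by
  let eι := Fintype.equivFin ι
  let eκ : Fin (Fintype.card ι) ≃ κ := (Fintype.equivFinOfCardEq hcard).symm
  let σ := Tuple.sort (key ∘ eκ)
  have hσ : Monotone ((key ∘ eκ) ∘ σ) := Tuple.monotone_sort _
  let P : Matrix (Fin (Fintype.card ι)) (Fin (Fintype.card ι)) R :=
    Matrix.of fun i j => e' ((σ.trans eκ) j) (eι.symm i)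
  let Q : Matrix (Fin (Fintype.card ι)) (Fin (Fintype.card ι)) R :=
    Matrix.of fun i j => e ((σ.trans eκ) j) (eι.symm i)
  have hP : IsUnit P := isUnit_of_span_eq_top eι (σ.trans eκ) he'
  have hQ : IsUnit Q := isUnit_of_span_eq_top eι (σ.trans eκ) he
  have hPQ : reindex eι eι A * Q = P * diagonal (s ∘ σ.trans eκ) := by
    ext i j
    have h := congrFun (hA ((σ.trans eκ) j)) (eι.symm i)
    rw [mulVec, dotProduct, ← Equiv.sum_comp eι.symm, Pi.smul_apply, smul_eq_mul, mul_comm] at h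
    rw [mul_diagonal, mul_apply]
    exact h
  have hdiag : P⁻¹ * reindex eι eι A * Q = diagonal (s ∘ σ.trans eκ) := by
    rw [Matrix.mul_assoc, hPQ, nonsing_inv_mul_cancel_left _ _ ((isUnit_iff_isUnit_det P).1 hP)]
  refine ⟨eι, eι, P⁻¹, Q, ?_, hQ, fun i j hij => ?_, fun i h₁ h₂ => ?_⟩
  · rwa [isUnit_nonsing_inv_iff]
  · rw [hdiag, diagonal_apply_ne _ fun h => hij (congrArg Fin.val h)]
  · rw [hdiag, diagonal_apply_eq, diagonal_apply_eq]
    exact hs _ _ (hσ (Fin.mk_le_mk.2 (Nat.le_succ i)))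

/-- A sequence which is congruent to `w` modulo earlier terms, and which is sent by the matrix to
multiples of `w 0` modulo the next term of `w`. -/
def alternating {M : Type*} [AddCommGroup M] [Module R M] (α : ℕ → R) (w : ℕ → M) : ℕ → M
  | 0 => w 0
  | m + 1 => w (m + 1) - α (m + 1) • alternating α w m

lemma alternating_sub_mem {M : Type*} [AddCommGroup M] [Module R M] (α : ℕ → R) (w : ℕ → M)
    (S : Submodule R M) (m : ℕ) (h : ∀ k < m, w k ∈ S) : alternating α w m - w m ∈ S := by
  induction m with
  | zero => simp [alternating]
  | succ m ih =>
    have h1 := S.add_mem (ih fun k hk => h k (by omega)) (h m (by omega))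
    rw [sub_add_cancel] at h1
    rw [alternating, sub_right_comm, sub_self, zero_sub]
    exact S.neg_mem (S.smul_mem _ h1)

lemma mulVec_alternating (A : Matrix ι ι R) (α : ℕ → R) (w : ℕ → ι → R) (m : ℕ)
    (h : ∀ k ≤ m, A *ᵥ w k = α k • w k + w (k + 1)) : A *ᵥ alternating α w m =
      w (m + 1) + ((-1) ^ m * ∏ k ∈ Finset.range (m + 1), α k) • w 0 := by
  induction m with
  | zero => simp [alternating, h 0 le_rfl, add_comm]
  | succ m ih =>
    rw [alternating, mulVec_sub, mulVec_smul, h _ le_rfl, ih fun k hk => h k (by omega),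
      Finset.prod_range_succ _ (m + 1), pow_succ]
    module

/-- A matrix acting on a space spanned by chains like a direct sum of bidiagonal blocks, whose
diagonals are initial segments of a common sequence, has Smith normal form. -/
lemma hasSNF'_of_chains (A : Matrix ι ι R) {N : κ → ℕ} (α : ℕ → R) {w : κ → ℕ → ι → R}
    (hw : ∀ i, ∀ j ≤ N i, A *ᵥ w i j = α j • w i j + w i (j + 1))
    (hzero : ∀ i, w i (N i + 1) = 0)
    (hspan : ∀ S : Submodule R (ι → R), (∀ i, ∀ j ≤ N i, w i j ∈ S) → S = ⊤)
    (hcard : Fintype.card (Σ i, Fin (N i + 1)) = Fintype.card ι) : A.HasSNF' := by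
  let e : (Σ i, Fin (N i + 1)) → ι → R := fun p =>
    if (p.2 : ℕ) = N p.1 then alternating α (w p.1) p.2 else w p.1 p.2
  let e' : (Σ i, Fin (N i + 1)) → ι → R := fun p =>
    if (p.2 : ℕ) = N p.1 then (-1 : R) ^ N p.1 • w p.1 0
    else α p.2 • w p.1 p.2 + w p.1 (p.2 + 1)
  let s : (Σ i, Fin (N i + 1)) → R := fun p =>
    if (p.2 : ℕ) = N p.1 then ∏ k ∈ Finset.range (N p.1 + 1), α k else 1
  refine A.hasSNF'_of_mulVec_eq_smul (e := e) (e' := e') (s := s) hcard ?_ ?_ (fun p => ?_)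
    (fun p => if (p.2 : ℕ) = N p.1 then N p.1 + 1 else 0) (fun p q hpq => ?_)
  · refine hspan _ fun i j hj => ?_
    have hlt : ∀ k < N i, w i k ∈ Submodule.span R (Set.range e) := fun k hk =>
      Submodule.subset_span ⟨⟨i, k, by omega⟩, if_neg hk.ne⟩
    rcases hj.lt_or_eq with hj | rfl
    · exact hlt j hj
    · have h1 := alternating_sub_mem α (w i) _ (N i) hlt
      have h2 : alternating α (w i) (N i) ∈ Submodule.span R (Set.range e) :=
        Submodule.subset_span ⟨⟨i, N i, by omega⟩, if_pos rfl⟩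
      simpa using Submodule.sub_mem _ h2 h1
  · refine hspan _ fun i j hj => ?_
    induction j with
    | zero =>
      have h : (-1 : R) ^ N i • w i 0 ∈ Submodule.span R (Set.range e') :=
        Submodule.subset_span ⟨⟨i, N i, by omega⟩, if_pos rfl⟩
      have h' := Submodule.smul_mem _ ((-1 : R) ^ N i) h
      rwa [smul_smul, ← mul_pow, neg_one_mul, neg_neg, one_pow, one_smul] at h'
    | succ j ih =>
      have h : α j • w i j + w i (j + 1) ∈ Submodule.span R (Set.range e') :=
        Submodule.subset_span ⟨⟨i, j, by omega⟩, if_neg (Nat.ne_of_lt hj)⟩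
      have h' := Submodule.sub_mem _ h (Submodule.smul_mem _ (α j) (ih (by omega)))
      rwa [add_sub_cancel_left] at h'
  · obtain ⟨i, j, hj⟩ := p
    by_cases h : j = N i
    · subst h
      simp only [e, e', s, if_true]
      rw [mulVec_alternating A α (w i) (N i) (hw i), hzero, zero_add, smul_smul, mul_comm]
    · simp only [e, e', s, if_neg h]
      rw [hw i j (by omega), one_smul]
  · obtain ⟨i, j, hj⟩ := p
    obtain ⟨i', j', hj'⟩ := q
    by_cases h : j = N i
    · by_cases h' : j' = N i'
      · simp only [s, if_pos h, if_pos h'] at hpq ⊢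
        exact Finset.prod_dvd_prod_of_subset _ _ _ (Finset.range_mono hpq)
      · simp [h, h'] at hpq
    · simp [s, h]

end SmithNormalForm

end Matrix

namespace YoungTuple

section Transfer

open scoped Matrix

variable {r : ℕ} {R : Type*} [CommRing R]

/-- The coordinates on the `n`-th rank. -/
noncomputable def coords (R : Type*) [CommRing R] (r n : ℕ) :
    ((Fin r → YoungDiagram) →₀ R) →ₗ[R] (YLevel r n → R) :=
  LinearMap.pi fun x => Finsupp.lapply x.1

lemma coords_single {n : ℕ} (x : YLevel r n) :
    coords R r n (Finsupp.single x.1 1) = Pi.single x 1 := by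
  classical
  funext y
  simp [coords, Finsupp.single_apply, Pi.single_apply, Subtype.ext_iff, eq_comm]

lemma yUpMatrix_mulVec_coords {n : ℕ} {f : (Fin r → YoungDiagram) →₀ R} (hf : f ∈ level R r n) :
    yUpMatrix R r n *ᵥ coords R r n f = coords R r (n + 1) (up R r f) := by
  have h : level R r n ≤ LinearMap.eqLocus ((yUpMatrix R r n).mulVecLin ∘ₗ coords R r n)
      (coords R r (n + 1) ∘ₗ up R r) := level_le fun x hx => by
    rw [LinearMap.mem_eqLocus, LinearMap.comp_apply, LinearMap.comp_apply,
      coords_single ⟨x, hx⟩, Matrix.mulVecLin_apply, Matrix.mulVec_single_one]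
    funext y
    simp [coords, up_single_apply, yUpMatrix]
  exact h hf

lemma yDownMatrix_mulVec_coords {n : ℕ} {f : (Fin r → YoungDiagram) →₀ R}
    (hf : f ∈ level R r (n + 1)) :
    yDownMatrix R r n *ᵥ coords R r (n + 1) f = coords R r n (down R r f) := by
  have h : level R r (n + 1) ≤
      LinearMap.eqLocus ((yDownMatrix R r n).mulVecLin ∘ₗ coords R r (n + 1))
        (coords R r n ∘ₗ down R r) := level_le fun x hx => by
    rw [LinearMap.mem_eqLocus, LinearMap.comp_apply, LinearMap.comp_apply,
      coords_single ⟨x, hx⟩, Matrix.mulVecLin_apply, Matrix.mulVec_single_one]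
    funext y
    simp [coords, down_single_apply, yDownMatrix]
  exact h hf

lemma yDuMatrix_add_smul_one_mulVec_coords {n : ℕ} (ξ : R) {f : (Fin r → YoungDiagram) →₀ R}
    (hf : f ∈ level R r n) : (yDuMatrix R r n + ξ • 1) *ᵥ coords R r n f =
      coords R r n ((down R r * up R r) f + ξ • f) := by
  rw [Matrix.add_mulVec, Matrix.smul_mulVec, Matrix.one_mulVec, yDuMatrix,
    ← Matrix.mulVec_mulVec, yUpMatrix_mulVec_coords hf, yDownMatrix_mulVec_coords (up_mem_level hf),
    map_add, map_smul, Module.End.mul_apply]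

lemma yDuMatrix_map {S : Type*} [CommRing S] (φ : R →+* S) (n : ℕ) :
    (yDuMatrix R r n).map φ = yDuMatrix S r n := by
  rw [yDuMatrix, Matrix.map_mul, yDuMatrix]
  congr 1 <;> ext <;> simp [yUpMatrix, yDownMatrix]

lemma hasSNF'_yDuMatrix_add_smul_one_of_good {a b : Fin r} (hab : a = b → r = 1) {n : ℕ}
    (hn : Good a b n) (ξ : R) : (yDuMatrix R r n + ξ • 1).HasSNF' := by
  classical
  have : Fintype (Core a b n) := Fintype.ofFinite _
  let α : ℕ → R := fun j => ((if a = b ∧ j + 1 = n then n + 1 else r * (j + 1) : ℕ) : R) + ξ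
  let w : Core a b n → ℕ → YLevel r n → R := fun x j =>
    if j ≤ n - size x.1 then coords R r n (updown R r j (coreVec R hab x)) else 0
  have hw : ∀ x, ∀ j ≤ n - size x.1, w x j = coords R r n (updown R r j (coreVec R hab x)) :=
    fun x j hj => if_pos hj
  refine Matrix.hasSNF'_of_chains _ (N := fun x : Core a b n => n - size x.1) α (w := w)
    (fun x j hj => ?_) (fun x => if_neg (by omega)) (fun S hS => ?_) ?_
  · have hpos := x.2.1.1
    have hle := x.2.2
    have h := LinearMap.congr_fun (down_mul_up_mul_updown (R := R) (r := r) j) (coreVec R hab x)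
    have h : (down R r * up R r) (updown R r j (coreVec R hab x)) =
        updown R r (j + 1) (coreVec R hab x) + (r * (j + 1)) • updown R r j (coreVec R hab x) := h
    have hmem := updown_mem_level (R := R) (j := j) (by omega) (coreVec_mem_level hab x)
    rw [hw x j hj, yDuMatrix_add_smul_one_mulVec_coords ξ hmem, h]
    rcases hj.lt_or_eq with hlt | heq
    · have hα : α j = ((r * (j + 1) : ℕ) : R) + ξ := by
        simp only [α]
        rw [if_neg]
        rintro ⟨h1, h2⟩
        have := hpos h1
        omega
      rw [hw x (j + 1) hlt, hα, add_smul, Nat.cast_smul_eq_nsmul]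
      simp only [map_add, map_nsmul, map_smul]
      abel
    · have hz : w x (j + 1) = 0 := if_neg (by omega)
      rw [hz, add_zero]
      by_cases hs : a = b ∧ size x.1 = 1
      · obtain ⟨m, rfl⟩ : ∃ m, n = m + 1 := ⟨n - 1, by omega⟩
        obtain rfl : j = m := by omega
        have hr := hab hs.1
        have hα : α j = ((1 + r * (j + 1) : ℕ) : R) + ξ := by
          simp only [α]
          rw [if_pos ⟨hs.1, trivial⟩, hr, one_mul, add_comm 1]
        rw [updown_succ_eq_updown hr (coreVec_mem_level hab x), hα, add_smul,
          Nat.cast_smul_eq_nsmul, add_smul, one_smul]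
        simp only [map_add, map_nsmul, map_smul]
      · have hα : α j = ((r * (j + 1) : ℕ) : R) + ξ := by
          simp only [α]
          rw [if_neg]
          rintro ⟨h1, h2⟩
          exact hs ⟨h1, by omega⟩
        rw [heq, updown_coreVec_eq_zero hab x hs, ← heq, zero_add, hα, add_smul,
          Nat.cast_smul_eq_nsmul]
        simp only [map_add, map_nsmul, map_smul]
  · rw [eq_top_iff, ← (Pi.basisFun R (YLevel r n)).span_eq, Submodule.span_le]
    rintro _ ⟨x, rfl⟩
    rw [Pi.basisFun_apply, ← coords_single]
    refine (Submodule.span_le.2 ?_ : _ ≤ S.comap (coords R r n))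
      (single_mem_span_updown_coreVec hab hn x.2)
    rintro _ ⟨y, j, hj, rfl⟩
    have hj : j ≤ n - size y.1 := by omega
    have hmem := hS y j hj
    rw [hw y j hj] at hmem
    exact hmem
  · rw [← Nat.card_eq_fintype_card, ← Nat.card_eq_fintype_card]
    exact card_sigma_core hab hn

lemma hasSNF'_of_subsingleton {ι : Type*} [Fintype ι] [Subsingleton ι] (A : Matrix ι ι R) :
    A.HasSNF' := by
  have h := Fintype.card_le_one_iff_subsingleton.2 ‹Subsingleton ι›
  refine ⟨Fintype.equivFin ι, Fintype.equivFin ι, 1, 1, isUnit_one, isUnit_one,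
    fun i j hij => ?_, fun i h₁ _ => ?_⟩ <;> omega

lemma hasSNF'_yDuMatrix_add_smul_one (hr : 1 ≤ r) (n : ℕ) (ξ : R) :
    (yDuMatrix R r n + ξ • 1).HasSNF' := by
  rcases hr.eq_or_lt with rfl | hr
  · rcases n.eq_zero_or_pos with rfl | hn
    · have : Subsingleton (YLevel 1 0) := ⟨fun x y => Subtype.ext
        ((eq_bot_of_size_eq_zero x.2).trans (eq_bot_of_size_eq_zero y.2).symm)⟩
      exact hasSNF'_of_subsingleton _
    · exact hasSNF'_yDuMatrix_add_smul_one_of_good (a := 0) (b := 0) (fun _ => rfl) (fun _ => hn) ξ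
  · have hne : (⟨0, by omega⟩ : Fin r) ≠ ⟨1, hr⟩ := by simp
    exact hasSNF'_yDuMatrix_add_smul_one_of_good (fun h => absurd h hne) (fun h => absurd h hne) ξ

end Transfer

end YoungTuple

/-- For every `r ≥ 1`, the `r`-fold Cartesian product `Y^r` of Young's
lattice (ordered componentwise and graded by the total number of cells) is an
`r`-differential poset, and for every `n ≥ 0` the matrix `[DU_n] + x·I_{p_n}` of `Y^r` has
Smith normal form over `ℤ[x]`. -/
theorem young_power_differential_and_snf (r : ℕ) (hr : 1 ≤ r) :
    ((∀ x y : Fin r → YoungDiagram, (Set.Icc x y).Finite) ∧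
     (∀ n : ℕ, {x : Fin r → YoungDiagram | ∑ i, (x i).card = n}.Finite) ∧
     (∀ x : Fin r → YoungDiagram, ⊥ ≤ x) ∧
     (∑ i : Fin r, ((⊥ : Fin r → YoungDiagram) i).card = 0) ∧
     (∀ x y : Fin r → YoungDiagram, x ⋖ y → ∑ i, (y i).card = (∑ i, (x i).card) + 1) ∧
     (∀ x y : Fin r → YoungDiagram, x ≠ y →
       {z : Fin r → YoungDiagram | z ⋖ x ∧ z ⋖ y}.ncard =
         {z : Fin r → YoungDiagram | x ⋖ z ∧ y ⋖ z}.ncard) ∧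
     (∀ x : Fin r → YoungDiagram,
       {z : Fin r → YoungDiagram | x ⋖ z}.ncard =
         {z : Fin r → YoungDiagram | z ⋖ x}.ncard + r)) ∧
    (∀ n : ℕ, Matrix.HasSNF' ((yDuMatrix ℤ r n).map (C : ℤ → ℤ[X]) +
      (X : ℤ[X]) • (1 : Matrix (YLevel r n) (YLevel r n) ℤ[X]))) := by
  refine ⟨⟨fun x y => (YoungTuple.finite_Iic y).subset Set.Icc_subset_Iic_self,
    yrLevel_finite r, fun _ => bot_le, YoungTuple.size_bot,
    fun _ _ => YoungTuple.size_eq_of_covBy, fun _ _ => YoungTuple.ncard_common_covers,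
    YoungTuple.ncard_upperCovers⟩, fun n => ?_⟩
  have h := YoungTuple.hasSNF'_yDuMatrix_add_smul_one hr n (X : ℤ[X])
  rwa [← YoungTuple.yDuMatrix_map (C : ℤ →+* ℤ[X])] at h
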